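/- arXiv:2312.14749 — 3 statements merged into one kernel-verified Lean document; each statement's English description precedes it below -/
import Mathlib

section
/- For every nonempty information set I ⊆ {0,...,N-1}, the minimum distance of the plain polar code P(I) equals min_{i∈I} 2^{w(i)}. -/
open Matrix

/-- The polar transform `G_N`, the `n`-fold Kronecker power of `[[1,0],[1,1]]` over `F₂`,
indexed MSB-first. -/
def polarG : (n : ℕ) → Matrix (Fin (2 ^ n)) (Fin (2 ^ n)) (ZMod 2)
  | 0 => 1
  | n + 1 =>
      Matrix.reindex (finProdFinEquiv.trans (finCongr (by ring)))
        (finProdFinEquiv.trans (finCongr (by ring)))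
        (Matrix.kroneckerMap (· * ·)
          (!![1, 0; 1, 1] : Matrix (Fin 2) (Fin 2) (ZMod 2)) (polarG n))

/-- Binary Hamming weight of `i`: the number of ones among bits `0,...,n-1`. -/
def bitWeight (n i : ℕ) : ℕ := ((Finset.range n).filter (fun l => i.testBit l)).card

/-- Left-swap rule of the polar partial order. -/
def leftSwap (i j : ℕ) : Prop :=
  ∃ l, i.testBit l = true ∧ i.testBit (l + 1) = false ∧
    j.testBit l = false ∧ j.testBit (l + 1) = true ∧
    ∀ l', l' ≠ l → l' ≠ l + 1 → i.testBit l' = j.testBit l'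

/-- Binary-domination rule of the polar partial order: `i_(l) ≤ j_(l)` for all `l`. -/
def binDom (i j : ℕ) : Prop := ∀ l, i.testBit l = true → j.testBit l = true

/-- The polar partial order: reflexive-transitive closure of the two rules. -/
def polarLE : ℕ → ℕ → Prop :=
  Relation.ReflTransGen (fun i j => leftSwap i j ∨ binDom i j)

/-- The plain polar code with information set `I`. -/
def polarCode (n : ℕ) (I : Finset (Fin (2 ^ n))) : Set (Fin (2 ^ n) → ZMod 2) :=
  { c | ∃ u : Fin (2 ^ n) → ZMod 2, (∀ j, j ∉ I → u j = 0) ∧ c = u ᵥ* polarG n }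

/-- The pre-transformed polar code with rate profile `I` and pre-transform `T`. -/
def ptpc (n : ℕ) (I : Finset (Fin (2 ^ n)))
    (T : Matrix (Fin (2 ^ n)) (Fin (2 ^ n)) (ZMod 2)) : Set (Fin (2 ^ n) → ZMod 2) :=
  { c | ∃ v : Fin (2 ^ n) → ZMod 2, (∀ j, j ∉ I → v j = 0) ∧ c = (v ᵥ* T) ᵥ* polarG n }

/-- `T` is upper triangular: `T i j = 0` whenever `i > j`. -/
def UpperTri {N : ℕ} (T : Matrix (Fin N) (Fin N) (ZMod 2)) : Prop :=
  ∀ i j : Fin N, j < i → T i j = 0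

/-- Minimum distance: the minimum Hamming weight of nonzero codewords. -/
noncomputable def dmin {N : ℕ} (C : Set (Fin N → ZMod 2)) : ℕ :=
  sInf { w | ∃ c ∈ C, c ≠ 0 ∧ hammingNorm c = w }

def polarE (n : ℕ) : Fin 2 × Fin (2 ^ n) ≃ Fin (2 ^ (n + 1)) :=
  finProdFinEquiv.trans (finCongr (by ring))

theorem polarE_val (n : ℕ) (a : Fin 2) (b : Fin (2 ^ n)) :
    (polarE n (a, b)).val = b.val + 2 ^ n * a.val := by
  simp [polarE, finProdFinEquiv]

theorem polarG_succ (n : ℕ) (a c : Fin 2) (b d : Fin (2 ^ n)) :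
    polarG (n + 1) (polarE n (a, b)) (polarE n (c, d)) =
      (!![1, 0; 1, 1] : Matrix (Fin 2) (Fin 2) (ZMod 2)) a c * polarG n b d := by
  have h : polarG (n + 1) = Matrix.reindex (polarE n) (polarE n)
        (Matrix.kroneckerMap (· * ·)
          (!![1, 0; 1, 1] : Matrix (Fin 2) (Fin 2) (ZMod 2)) (polarG n)) := rfl
  rw [h]
  simp only [Matrix.reindex_apply, Matrix.submatrix_apply, Equiv.symm_apply_apply,
    Matrix.kroneckerMap_apply]

theorem norm_split (n : ℕ) (f : Fin (2 ^ (n + 1)) → ZMod 2) :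
    hammingNorm f = hammingNorm (fun b => f (polarE n (0, b))) +
      hammingNorm (fun b => f (polarE n (1, b))) := by
  simp only [hammingNorm, Finset.card_filter]
  rw [← (polarE n).sum_comp, Fintype.sum_prod_type, Fin.sum_univ_two]

theorem bitWeight_zero_half (n : ℕ) (b : Fin (2 ^ n)) :
    bitWeight (n + 1) (polarE n (0, b)).val = bitWeight n b.val := by
  rw [polarE_val]
  have h : b.val.testBit n = false := Nat.testBit_lt_two_pow b.isLt
  simp [bitWeight, Finset.range_add_one, Finset.filter_insert, h]

theorem bitWeight_one_half (n : ℕ) (b : Fin (2 ^ n)) :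
    bitWeight (n + 1) (polarE n (1, b)).val = bitWeight n b.val + 1 := by
  rw [polarE_val]
  have h : b.val.testBit n = false := Nat.testBit_lt_two_pow b.isLt
  have h1 : (2 ^ n + b.val).testBit n = true := by
    rw [Nat.testBit_two_pow_add_eq, h]; rfl
  have h2 : ∀ l ∈ Finset.range n, ((2 ^ n + b.val).testBit l = true ↔ b.val.testBit l = true) := by
    intro l hl
    rw [Nat.testBit_two_pow_add_gt (Finset.mem_range.mp hl)]
  have e : b.val + 2 ^ n * (1 : Fin 2).val = 2 ^ n + b.val := by simp [add_comm]
  rw [e]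
  unfold bitWeight
  rw [Finset.range_add_one, Finset.filter_insert, if_pos h1, Finset.card_insert_of_notMem (by simp),
    Finset.filter_congr h2]

theorem vecMul_zero_half (n : ℕ) (u : Fin (2 ^ (n + 1)) → ZMod 2) :
    (fun b => (u ᵥ* polarG (n + 1)) (polarE n (0, b))) =
      ((fun b => u (polarE n (0, b))) + (fun b => u (polarE n (1, b)))) ᵥ* polarG n := by
  funext d
  simp only [Matrix.vecMul, dotProduct, Pi.add_apply]
  rw [← (polarE n).sum_comp, Fintype.sum_prod_type, Fin.sum_univ_two, ← Finset.sum_add_distrib]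
  refine Finset.sum_congr rfl fun b _ => ?_
  rw [polarG_succ, polarG_succ]
  simp [add_mul]

theorem vecMul_one_half (n : ℕ) (u : Fin (2 ^ (n + 1)) → ZMod 2) :
    (fun b => (u ᵥ* polarG (n + 1)) (polarE n (1, b))) =
      (fun b => u (polarE n (1, b))) ᵥ* polarG n := by
  funext d
  simp only [Matrix.vecMul, dotProduct]
  rw [← (polarE n).sum_comp, Fintype.sum_prod_type, Fin.sum_univ_two, ← Finset.sum_add_distrib]
  refine Finset.sum_congr rfl fun b _ => ?_
  rw [polarG_succ, polarG_succ]
  simp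

theorem row_weight (n : ℕ) (i : Fin (2 ^ n)) :
    hammingNorm (polarG n i) = 2 ^ bitWeight n i.val := by
  induction n with
  | zero =>
    have : ∀ j : Fin (2 ^ 0), polarG 0 i j = 1 := by
      intro j
      have : i = j := Subsingleton.elim (α := Fin 1) i j
      subst this
      simp [polarG]
    simp [hammingNorm, this, bitWeight]
  | succ n ih =>
    obtain ⟨⟨a, b⟩, rfl⟩ := (polarE n).surjective i
    rw [norm_split]
    simp only [polarG_succ]
    have ihb := ih b
    fin_cases a
    · have := bitWeight_zero_half n b
      simp at this ⊢
      rw [this, ← ihb]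
      simp [hammingNorm]
    · have := bitWeight_one_half n b
      simp at this ⊢
      rw [this, pow_succ, ← ihb]
      simp [hammingNorm, mul_two]

theorem exists_weight_le (n : ℕ) (u : Fin (2 ^ n) → ZMod 2) (hu : u ≠ 0) :
    ∃ i, u i ≠ 0 ∧ 2 ^ bitWeight n i.val ≤ hammingNorm (u ᵥ* polarG n) := by
  induction n with
  | zero =>
    obtain ⟨i, hi⟩ := Function.ne_iff.mp hu
    refine ⟨i, hi, ?_⟩
    have h : u ᵥ* polarG 0 = u := by simp [polarG]
    rw [h]
    simpa [bitWeight, Nat.one_le_iff_ne_zero] using hu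
  | succ n ih =>
    rw [norm_split, vecMul_zero_half, vecMul_one_half]
    set u0 : Fin (2 ^ n) → ZMod 2 := fun b => u (polarE n (0, b)) with h0
    set u1 : Fin (2 ^ n) → ZMod 2 := fun b => u (polarE n (1, b)) with h1
    by_cases hz1 : u1 = 0
    · have hz0 : u0 ≠ 0 := by
        intro hz0
        apply hu
        funext k
        obtain ⟨⟨a, b⟩, rfl⟩ := (polarE n).surjective k
        fin_cases a
        · exact congrFun hz0 b
        · exact congrFun hz1 b
      obtain ⟨i, hi, hw⟩ := ih u0 hz0
      refine ⟨polarE n (0, i), hi, ?_⟩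
      rw [bitWeight_zero_half, hz1, add_zero]
      omega
    · obtain ⟨j, hj, hjw⟩ := ih u1 hz1
      by_cases hs : u0 + u1 = 0
      · have hj0 : u0 j ≠ 0 := by
          intro h
          have := congrFun hs j
          simp only [Pi.add_apply, h, zero_add] at this
          exact hj this
        refine ⟨polarE n (0, j), hj0, ?_⟩
        rw [bitWeight_zero_half]
        omega
      · obtain ⟨i, hi, hiw⟩ := ih _ hs
        by_cases hi0 : u0 i = 0
        · have hi1 : u1 i ≠ 0 := by
            intro h
            exact hi (by simp only [Pi.add_apply, h, hi0, zero_add])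
          rcases le_total (2 ^ bitWeight n i.val) (2 ^ bitWeight n j.val) with h | h
          · refine ⟨polarE n (1, i), hi1, ?_⟩
            rw [bitWeight_one_half, pow_succ]
            omega
          · refine ⟨polarE n (1, j), hj, ?_⟩
            rw [bitWeight_one_half, pow_succ]
            omega
        · refine ⟨polarE n (0, i), hi0, ?_⟩
          rw [bitWeight_zero_half]
          omega

/-- For every nonempty information set `I`, the minimum distance of the
plain polar code `P(I)` equals `min_{i∈I} 2^{w(i)}`. -/
theorem stmt4 (n : ℕ) (I : Finset (Fin (2 ^ n))) (hI : I.Nonempty) :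
    dmin (polarCode n I) = I.inf' hI (fun i => 2 ^ bitWeight n i.val) := by
  apply le_antisymm
  · obtain ⟨i, hi, he⟩ := Finset.exists_mem_eq_inf' hI (fun i => 2 ^ bitWeight n i.val)
    rw [he]
    apply Nat.sInf_le
    refine ⟨polarG n i, ⟨Pi.single i 1, ?_, ?_⟩, ?_, row_weight n i⟩
    · intro j hj
      exact Pi.single_eq_of_ne (by rintro rfl; exact hj hi) _
    · rw [Matrix.single_one_vecMul]; rfl
    · intro h
      have := row_weight n i
      rw [h, hammingNorm_zero] at this
      exact (pow_pos (by norm_num : 0 < 2) _).ne this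
  · apply le_csInf
    · obtain ⟨i, hi⟩ := hI
      refine ⟨_, polarG n i, ⟨Pi.single i 1, ?_, ?_⟩, ?_, rfl⟩
      · intro j hj
        exact Pi.single_eq_of_ne (by rintro rfl; exact hj hi) _
      · rw [Matrix.single_one_vecMul]; rfl
      · intro h
        have := row_weight n i
        rw [h, hammingNorm_zero] at this
        exact (pow_pos (by norm_num : 0 < 2) _).ne this
    · rintro w ⟨c, ⟨u, hu, rfl⟩, hc, rfl⟩
      have hu0 : u ≠ 0 := by
        rintro rfl
        simp at hc
      obtain ⟨i, hi, hw⟩ := exists_weight_le n u hu0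
      refine le_trans (Finset.inf'_le _ ?_) hw
      by_contra h
      exact hi (hu i h)
end

section
/- Let I ⊆ {0,...,N-1} be nonempty and let T be upper triangular over F₂ with t_{i,i} = 1 for all i ∈ I. Then every nonzero codeword c of the pre-transformed polar code P(I,T) satisfies w(c) ≥ min_{i∈I} 2^{w(i)}; in particular d_min(P(I,T)) ≥ d_min(P(I)). -/
open Matrix

/-- MSB-first splitting of the index set. -/
def splitE (n : ℕ) : Fin 2 × Fin (2 ^ n) ≃ Fin (2 ^ (n + 1)) :=
  finProdFinEquiv.trans (finCongr (by ring))

theorem splitE_val (n : ℕ) (a : Fin 2) (j : Fin (2 ^ n)) :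
    (splitE n (a, j)).val = j.val + 2 ^ n * a.val := by
  simp [splitE, finProdFinEquiv]

theorem polarG_split (n : ℕ) (a b : Fin 2) (j k : Fin (2 ^ n)) :
    polarG (n + 1) (splitE n (a, j)) (splitE n (b, k)) =
      (!![1, 0; 1, 1] : Matrix (Fin 2) (Fin 2) (ZMod 2)) a b * polarG n j k := by
  have h : polarG (n + 1) = Matrix.reindex (splitE n) (splitE n)
        (Matrix.kroneckerMap (· * ·)
          (!![1, 0; 1, 1] : Matrix (Fin 2) (Fin 2) (ZMod 2)) (polarG n)) := rfl
  rw [h, Matrix.reindex_apply, Matrix.submatrix_apply, Equiv.symm_apply_apply,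
    Equiv.symm_apply_apply, Matrix.kroneckerMap_apply]

theorem vecMul_split (n : ℕ) (u : Fin (2 ^ (n + 1)) → ZMod 2) (b : Fin 2) (k : Fin (2 ^ n)) :
    (u ᵥ* polarG (n + 1)) (splitE n (b, k)) =
      ((!![1, 0; 1, 1] : Matrix (Fin 2) (Fin 2) (ZMod 2)) 0 b) *
          ((fun j => u (splitE n (0, j))) ᵥ* polarG n) k
        + ((!![1, 0; 1, 1] : Matrix (Fin 2) (Fin 2) (ZMod 2)) 1 b) *
          ((fun j => u (splitE n (1, j))) ᵥ* polarG n) k := by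
  simp only [Matrix.vecMul, dotProduct]
  rw [← (splitE n).sum_comp, Fintype.sum_prod_type, Fin.sum_univ_two, Finset.mul_sum,
    Finset.mul_sum]
  simp only [polarG_split]
  congr 1 <;> exact Finset.sum_congr rfl fun _ _ => by ring

theorem hammingNorm_sum {m : ℕ} (c : Fin m → ZMod 2) :
    hammingNorm c = ∑ i, if c i ≠ 0 then 1 else 0 := by
  simp [hammingNorm, Finset.card_filter]

theorem norm_split_s5 (n : ℕ) (u : Fin (2 ^ (n + 1)) → ZMod 2) :
    hammingNorm (u ᵥ* polarG (n + 1)) =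
      hammingNorm ((fun j => u (splitE n (0, j))) ᵥ* polarG n
          + (fun j => u (splitE n (1, j))) ᵥ* polarG n)
        + hammingNorm ((fun j => u (splitE n (1, j))) ᵥ* polarG n) := by
  simp only [hammingNorm_sum]
  rw [← (splitE n).sum_comp, Fintype.sum_prod_type, Fin.sum_univ_two]
  simp only [vecMul_split]
  simp

theorem bitWeight_low (n j : ℕ) (hj : j < 2 ^ n) : bitWeight (n + 1) j = bitWeight n j := by
  unfold bitWeight
  rw [Finset.range_add_one, Finset.filter_insert, if_neg]
  simp [Nat.testBit_lt_two_pow hj]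

theorem bitWeight_high (n j : ℕ) (hj : j < 2 ^ n) :
    bitWeight (n + 1) (j + 2 ^ n) = bitWeight n j + 1 := by
  unfold bitWeight
  rw [add_comm j, Finset.range_add_one, Finset.filter_insert, if_pos, Finset.card_insert_of_notMem]
  · congr 2
    apply Finset.filter_congr
    intro l hl
    rw [Nat.testBit_two_pow_add_gt (Finset.mem_range.1 hl)]
  · simp
  · rw [Nat.testBit_two_pow_add_eq, Nat.testBit_lt_two_pow hj]; rfl

theorem norm_triangle {m : ℕ} (a b : Fin m → ZMod 2) :
    hammingNorm a ≤ hammingNorm (a + b) + hammingNorm b := by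
  simp only [hammingNorm_sum, ← Finset.sum_add_distrib]
  apply Finset.sum_le_sum
  intro i _
  by_cases hb : b i = 0 <;> by_cases ha : a i = 0 <;> simp [ha, hb]

theorem key (n : ℕ) : ∀ (u : Fin (2 ^ n) → ZMod 2) (i : Fin (2 ^ n)), u i ≠ 0 →
    (∀ j, j < i → u j = 0) → 2 ^ bitWeight n i.val ≤ hammingNorm (u ᵥ* polarG n) := by
  induction n with
  | zero =>
    intro u i hi _
    have : u ≠ 0 := fun h => hi (by simp [h])
    simpa [bitWeight, polarG, Nat.one_le_iff_ne_zero] using this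
  | succ n ih =>
    intro u i hi hlt
    obtain ⟨⟨a, k⟩, rfl⟩ := (splitE n).surjective i
    rw [norm_split_s5]
    fin_cases a
    · refine le_trans ?_ (norm_triangle _ _)
      have := ih (fun j => u (splitE n (0, j))) k hi (fun j hj => hlt _ (by
        rw [Fin.lt_def] at hj ⊢; simp [splitE_val]; exact hj))
      simpa [splitE_val, bitWeight_low n k.val k.isLt] using this
    · have h0 : (fun j => u (splitE n (0, j))) = 0 := by
        funext j
        apply hlt
        rw [Fin.lt_def]; simp [splitE_val]; omega
      have := ih (fun j => u (splitE n (1, j))) k hi (fun j hj => hlt _ (by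
        rw [Fin.lt_def] at hj ⊢; simp [splitE_val]; exact hj))
      rw [h0, Matrix.zero_vecMul, zero_add]
      simp only [splitE_val]
      simp only [Fin.mk_one, Fin.val_one, mul_one, bitWeight_high n k.val k.isLt, pow_succ]
      omega

theorem row_norm (n : ℕ) : ∀ (i : Fin (2 ^ n)),
    hammingNorm ((Pi.single i 1 : Fin (2 ^ n) → ZMod 2) ᵥ* polarG n) =
      2 ^ bitWeight n i.val := by
  induction n with
  | zero =>
    intro i
    apply le_antisymm
    · refine (hammingNorm_le_card_fintype).trans ?_
      simp [bitWeight]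
    · exact key 0 _ i (by simp) (fun j hj => by simp [hj.ne])
  | succ n ih =>
    intro i
    obtain ⟨⟨a, k⟩, rfl⟩ := (splitE n).surjective i
    have hs : ∀ b : Fin 2, (fun j => (Pi.single (splitE n (a, k)) 1 : _ → ZMod 2)
        (splitE n (b, j))) = if b = a then Pi.single k 1 else 0 := by
      intro b
      funext j
      by_cases hb : b = a <;> by_cases hj : j = k <;> simp [Pi.single_apply, hb, hj]
    rw [norm_split_s5, hs, hs, splitE_val]
    fin_cases a
    · simpa [bitWeight_low n k.val k.isLt] using ih k
    · have := ih k
      simp [bitWeight_high n k.val k.isLt, pow_succ] at this ⊢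
      omega

theorem pre_key (n : ℕ) (I : Finset (Fin (2 ^ n)))
    (T : Matrix (Fin (2 ^ n)) (Fin (2 ^ n)) (ZMod 2))
    (hT : UpperTri T) (hTd : ∀ i ∈ I, T i i = 1) (v : Fin (2 ^ n) → ZMod 2)
    (hv : ∀ j, j ∉ I → v j = 0) (hv0 : v ≠ 0) :
    ∃ i ∈ I, 2 ^ bitWeight n i.val ≤ hammingNorm ((v ᵥ* T) ᵥ* polarG n) := by
  obtain ⟨i0, hi0⟩ := Function.ne_iff.1 hv0
  obtain ⟨i, hi, hmin⟩ := WellFounded.has_min (wellFounded_lt (α := Fin (2 ^ n)))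
    {i | v i ≠ 0} ⟨i0, hi0⟩
  have hmin' : ∀ j, j < i → v j = 0 := fun j hj => by
    by_contra h
    exact hmin j h hj
  have hiI : i ∈ I := by
    by_contra h
    exact hi (hv i h)
  refine ⟨i, hiI, key n _ i ?_ ?_⟩
  · have : (v ᵥ* T) i = v i := by
      simp only [Matrix.vecMul, dotProduct]
      rw [Finset.sum_eq_single i, hTd i hiI, mul_one]
      · intro k _ hk
        rcases lt_or_gt_of_ne hk with h | h
        · rw [hmin' k h, zero_mul]
        · rw [hT k i h, mul_zero]
      · simp
    rw [this]; exact hi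
  · intro j hj
    simp only [Matrix.vecMul, dotProduct]
    apply Finset.sum_eq_zero
    intro k _
    rcases lt_or_ge k i with h | h
    · rw [hmin' k h, zero_mul]
    · rw [hT k j (hj.trans_le h), mul_zero]


/-- Every nonzero codeword of `P(I,T)` has weight at least
`min_{i∈I} 2^{w(i)}`; in particular `d_min(P(I,T)) ≥ d_min(P(I))`. -/
theorem stmt5 (n : ℕ) (I : Finset (Fin (2 ^ n))) (hI : I.Nonempty)
    (T : Matrix (Fin (2 ^ n)) (Fin (2 ^ n)) (ZMod 2))
    (hT : UpperTri T) (hTd : ∀ i ∈ I, T i i = 1) :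
    (∀ c ∈ ptpc n I T, c ≠ 0 →
      I.inf' hI (fun i => 2 ^ bitWeight n i.val) ≤ hammingNorm c) ∧
    dmin (polarCode n I) ≤ dmin (ptpc n I T) := by
  have h1 : ∀ c ∈ ptpc n I T, c ≠ 0 →
      I.inf' hI (fun i => 2 ^ bitWeight n i.val) ≤ hammingNorm c := by
    rintro c ⟨v, hv, rfl⟩ hc
    obtain ⟨i, hi, h⟩ := pre_key n I T hT hTd v hv (by rintro rfl; simp at hc)
    exact (Finset.inf'_le _ hi).trans h
  refine ⟨h1, ?_⟩
  have hne : { w | ∃ c ∈ ptpc n I T, c ≠ 0 ∧ hammingNorm c = w }.Nonempty := by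
    obtain ⟨i, hi⟩ := hI
    have hv : ∀ j, j ∉ I → (Pi.single i 1 : Fin (2 ^ n) → ZMod 2) j = 0 := by
      intro j hj
      have : j ≠ i := by rintro rfl; exact hj hi
      simp [this]
    obtain ⟨k, _, h⟩ := pre_key n I T hT hTd (Pi.single i 1) hv (by simp)
    refine ⟨_, _, ⟨_, hv, rfl⟩, ?_, rfl⟩
    rw [← hammingNorm_pos_iff]
    exact lt_of_lt_of_le (by positivity) h
  obtain ⟨c, hc, hc0, hcw⟩ := Nat.sInf_mem hne
  obtain ⟨i, hi, hieq⟩ := Finset.exists_mem_eq_inf' hI (fun i => 2 ^ bitWeight n i.val)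
  have h2 := h1 c hc hc0
  rw [hieq, hcw] at h2
  refine le_trans (Nat.sInf_le ?_) h2
  refine ⟨_, ⟨Pi.single i 1, ?_, rfl⟩, ?_, row_norm n i⟩
  · intro j hj
    have : j ≠ i := by rintro rfl; exact hj hi
    simp [this]
  · rw [← hammingNorm_pos_iff, row_norm]
    positivity
end

section
/- Let I ⊆ {0,...,N-1} be nonempty and decreasing, let w_min = min_{i∈I} 2^{w(i)}, and let i° = N − N/w_min. Then i° ∈ I, every j with i° ≤ j ≤ N−1 belongs to I, and for every upper triangular T over F₂ with t_{i,i} = 1 for all i ∈ I, the row g_{i°} is a codeword of the pre-transformed polar code P(I,T); moreover w(g_{i°}) = w_min. -/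
open Matrix

theorem testBit_top (n m l : ℕ) (hm : m ≤ n) :
    (2 ^ n - 2 ^ m).testBit l = (decide (m ≤ l) && decide (l < n)) := by
  have h : 2 ^ n - 2 ^ m = 2 ^ m * (2 ^ (n - m) - 1) := by
    rw [Nat.mul_sub, ← pow_add, Nat.add_sub_cancel' hm, mul_one]
  rw [h, Nat.testBit_two_pow_mul, Nat.testBit_two_pow_sub_one]
  by_cases h1 : m ≤ l
  · have : (l - m < n - m) ↔ l < n := by omega
    simp [this]
  · simp [h1]

theorem bitWeight_le (n i : ℕ) : bitWeight n i ≤ n := by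
  unfold bitWeight
  exact (Finset.card_filter_le _ _).trans (by simp)

theorem bitWeight_top (n m : ℕ) (hm : m ≤ n) : bitWeight n (2 ^ n - 2 ^ m) = n - m := by
  unfold bitWeight
  have : (Finset.range n).filter (fun l => (2 ^ n - 2 ^ m).testBit l = true) = Finset.Ico m n := by
    ext l
    simp only [Finset.mem_filter, Finset.mem_range, Finset.mem_Ico, testBit_top n m l hm,
      Bool.and_eq_true, decide_eq_true_eq]
    omega
  rw [this, Nat.card_Ico]

theorem polarLE_top (n : ℕ) : ∀ d i : ℕ, 2 ^ n - i = d → i < 2 ^ n →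
    polarLE i (2 ^ n - 2 ^ (n - bitWeight n i)) := by
  intro d
  induction d using Nat.strong_induction_on with
  | _ d ih =>
  intro i hd hi
  by_cases hs : ∃ l, l + 1 < n ∧ i.testBit l = true ∧ i.testBit (l + 1) = false
  · obtain ⟨l, hl, h1, h2⟩ := hs
    have hb : ∀ x, (i ^^^ (2 ^ l ^^^ 2 ^ (l + 1))).testBit x =
        if x = l then false else if x = l + 1 then true else i.testBit x := by
      intro x
      rw [Nat.testBit_xor, Nat.testBit_xor, Nat.testBit_two_pow, Nat.testBit_two_pow]
      by_cases hx : x = l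
      · subst hx; simp [h1]
      · by_cases hx' : x = l + 1
        · subst hx'; simp [h2]
        · simp [hx, hx', Ne.symm hx, Ne.symm hx']
    set i' := i ^^^ (2 ^ l ^^^ 2 ^ (l + 1)) with hi'
    have hlt : i < i' := by
      refine Nat.lt_of_testBit (l + 1) h2 (by rw [hb]; simp) ?_
      intro x hx
      rw [hb, if_neg (by omega), if_neg (by omega)]
    have hlt' : i' < 2 ^ n := by
      refine Nat.xor_lt_two_pow hi (Nat.xor_lt_two_pow ?_ ?_)
      · exact Nat.pow_lt_pow_right (by norm_num) (by omega)
      · exact Nat.pow_lt_pow_right (by norm_num) hl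
    have hw : bitWeight n i' = bitWeight n i := by
      unfold bitWeight
      have : (Finset.range n).filter (fun x => i'.testBit x = true) =
          insert (l + 1) (((Finset.range n).filter (fun x => i.testBit x = true)).erase l) := by
        ext x
        simp only [Finset.mem_filter, Finset.mem_range, Finset.mem_insert, Finset.mem_erase, hb]
        by_cases hx : x = l
        · subst hx; simp
        · by_cases hx' : x = l + 1
          · subst hx'; simp [hl]
          · simp [hx, hx']
      have hm : l ∈ (Finset.range n).filter (fun x => i.testBit x = true) := by
        simp [h1]; omega
      rw [this, Finset.card_insert_of_notMem (by simp [h2]), Finset.card_erase_of_mem hm]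
      have := Finset.card_pos.mpr ⟨l, hm⟩
      omega
    have := ih (2 ^ n - i') (by omega) i' rfl hlt'
    rw [hw] at this
    refine Relation.ReflTransGen.head (Or.inl ⟨l, h1, h2, by rw [hb]; simp, by rw [hb]; simp, ?_⟩) this
    intro x hx hx'
    rw [hb, if_neg hx, if_neg hx']
  · push Not at hs
    have hex : ∃ m, n ≤ m ∨ i.testBit m = true := ⟨n, Or.inl le_rfl⟩
    classical
    obtain ⟨m, hm, hmin⟩ : ∃ m, (n ≤ m ∨ i.testBit m = true) ∧
        ∀ k < m, ¬ (n ≤ k ∨ i.testBit k = true) :=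
      ⟨Nat.find hex, Nat.find_spec hex, fun k hk => Nat.find_min hex hk⟩
    have hmn : m ≤ n := by
      by_contra h
      exact hmin n (by omega) (Or.inl le_rfl)
    have hup : ∀ k, m + k < n → i.testBit (m + k) = true := by
      intro k
      induction k with
      | zero => intro h; exact hm.resolve_left (by simpa using h)
      | succ k ihk =>
        intro h
        have := hs (m + k) (by omega) (ihk (by omega))
        simpa [add_assoc] using this
    have heq : i = 2 ^ n - 2 ^ m := by
      apply Nat.eq_of_testBit_eq
      intro l
      rw [testBit_top n m l hmn]
      by_cases h1 : m ≤ l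
      · by_cases h2 : l < n
        · have := hup (l - m) (by omega)
          rw [Nat.add_sub_cancel' h1] at this
          simp [h1, h2, this]
        · have : i.testBit l = false := Nat.testBit_lt_two_pow
            (hi.trans_le (Nat.pow_le_pow_right (by norm_num) (by omega)))
          simp [h2, this]
      · have := hmin l (by omega)
        simp at this
        simp [h1, this.2]
    have hw : bitWeight n i = n - m := by rw [heq, bitWeight_top n m hmn]
    rw [hw, Nat.sub_sub_self hmn, ← heq]
    exact Relation.ReflTransGen.refl

theorem binDom_top (n m j : ℕ) (hm : m ≤ n) (h : 2 ^ n - 2 ^ m ≤ j) (hj : j < 2 ^ n) :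
    binDom (2 ^ n - 2 ^ m) j := by
  intro l hl
  rw [testBit_top n m l hm] at hl
  simp only [Bool.and_eq_true, decide_eq_true_eq] at hl
  have hp : 2 ^ m ≤ 2 ^ n := Nat.pow_le_pow_right (by norm_num) hm
  have hr : 2 ^ n - 1 - j < 2 ^ n := by omega
  have hjr : j = 2 ^ n - (2 ^ n - 1 - j + 1) := by omega
  rw [hjr, Nat.testBit_two_pow_sub_succ hr]
  have h2 : 2 ^ m ≤ 2 ^ l := Nat.pow_le_pow_right (by norm_num) hl.1
  rw [Nat.testBit_lt_two_pow (show 2 ^ n - 1 - j < 2 ^ l by omega)]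
  simp [hl.2]

theorem bitWeight_succ (n : ℕ) (a : Fin 2) (b : ℕ) (hb : b < 2 ^ n) :
    bitWeight (n + 1) (b + 2 ^ n * a.val) = bitWeight n b + a.val := by
  unfold bitWeight
  rw [Finset.range_add_one, Finset.filter_insert]
  have h1 : (Finset.range n).filter (fun l => (b + 2 ^ n * a.val).testBit l = true) =
      (Finset.range n).filter (fun l => b.testBit l = true) := by
    apply Finset.filter_congr
    intro x hx
    rw [add_comm, Nat.testBit_two_pow_mul_add _ hb]
    simp [Finset.mem_range.mp hx]
  have h2 : (b + 2 ^ n * a.val).testBit n = (a.val).testBit 0 := by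
    rw [add_comm, Nat.testBit_two_pow_mul_add _ hb]
    simp
  rw [h1, h2]
  fin_cases a
  · simp
  · simp

theorem hammingNorm_polarG (n : ℕ) : ∀ i : Fin (2 ^ n),
    hammingNorm (polarG n i) = 2 ^ bitWeight n i.val := by
  induction n with
  | zero =>
    intro i
    have : i = ⟨0, by simp⟩ := by ext; have := i.isLt; simp at this ⊢
    subst this
    simp only [hammingNorm, polarG, bitWeight]
    decide
  | succ n ih =>
    intro i
    let e : Fin 2 × Fin (2 ^ n) ≃ Fin (2 ^ (n + 1)) :=
      finProdFinEquiv.trans (finCongr (by ring))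
    obtain ⟨⟨a, b⟩, rfl⟩ := e.surjective i
    have hv : (e (a, b)).val = b.val + 2 ^ n * a.val := by
      simp [e, finProdFinEquiv]
    rw [hv, bitWeight_succ n a b b.isLt, pow_add (2 : ℕ) (bitWeight n b.val), ← ih b]
    have hG : ∀ c d, polarG (n + 1) (e (a, b)) (e (c, d)) =
        (!![1, 0; 1, 1] : Matrix (Fin 2) (Fin 2) (ZMod 2)) a c * polarG n b d := by
      intro c d
      change (!![1, 0; 1, 1] : Matrix (Fin 2) (Fin 2) (ZMod 2)) (e.symm (e (a, b))).1
        (e.symm (e (c, d))).1 * polarG n (e.symm (e (a, b))).2 (e.symm (e (c, d))).2 = _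
      simp
    simp only [hammingNorm, Finset.card_filter]
    rw [← Equiv.sum_comp e, Fintype.sum_prod_type]
    simp only [hG, Fin.sum_univ_two]
    fin_cases a
    · simp
    · simp; ring

theorem exists_vecMul {N : ℕ} (T : Matrix (Fin N) (Fin N) (ZMod 2)) (hT : UpperTri T)
    (i₀ : Fin N) (hd : ∀ j, i₀ ≤ j → T j j = 1) :
    ∃ v : Fin N → ZMod 2, (∀ j, j < i₀ → v j = 0) ∧ v ᵥ* T = Pi.single i₀ 1 := by
  let T' : Matrix (Fin N) (Fin N) (ZMod 2) :=
    Matrix.of fun i j => if i₀ ≤ i then T i j else if i = j then 1 else 0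
  have hdet : T'.det = 1 := by
    rw [Matrix.det_of_isUpperTriangular]
    · apply Finset.prod_eq_one
      intro i _
      by_cases h : i₀ ≤ i
      · simp [T', h, hd i h]
      · simp [T', h]
    · intro i j hij
      have hij : j < i := hij
      by_cases h : i₀ ≤ i
      · simp [T', h, hT i j hij]
      · simp [T', h, hij.ne']
  have hu : IsUnit T'.det := by rw [hdet]; exact isUnit_one
  let v : Fin N → ZMod 2 := Pi.single i₀ 1 ᵥ* T'⁻¹
  have hv : v ᵥ* T' = Pi.single i₀ 1 := by
    simp only [v]
    rw [Matrix.vecMul_vecMul, Matrix.nonsing_inv_mul _ hu, Matrix.vecMul_one]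
  have h0 : ∀ j, j < i₀ → v j = 0 := by
    intro j hj
    have h := congrFun hv j
    rw [Pi.single_eq_of_ne hj.ne] at h
    rw [← h]
    simp only [Matrix.vecMul, dotProduct]
    rw [Finset.sum_eq_single j]
    · simp [T', not_le.mpr hj]
    · intro i _ hij
      by_cases h : i₀ ≤ i
      · simp [T', h, hT i j (hj.trans_le h)]
      · simp [T', h, hij]
    · simp
  refine ⟨v, h0, ?_⟩
  rw [← hv]
  ext j
  simp only [Matrix.vecMul, dotProduct]
  apply Finset.sum_congr rfl
  intro i _
  by_cases h : i₀ ≤ i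
  · simp [T', h]
  · simp [h0 i (not_le.mp h)]

/-- For nonempty decreasing `I` with `w_min = min_{i∈I} 2^{w(i)}` and
`i° = N − N/w_min`: `i° ∈ I`, every `j ≥ i°` is in `I`, `w(g_{i°}) = w_min`, and
`g_{i°}` is a codeword of `P(I,T)` for every admissible upper triangular `T`. -/
theorem stmt10 (n : ℕ) (I : Finset (Fin (2 ^ n))) (hI : I.Nonempty)
    (hdec : ∀ i ∈ I, ∀ j : Fin (2 ^ n), polarLE i.val j.val → j ∈ I)
    (i₀ : Fin (2 ^ n))
    (hi₀ : i₀.val = 2 ^ n - 2 ^ n / I.inf' hI (fun i => 2 ^ bitWeight n i.val)) :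
    i₀ ∈ I ∧ (∀ j : Fin (2 ^ n), i₀ ≤ j → j ∈ I) ∧
    hammingNorm (polarG n i₀) = I.inf' hI (fun i => 2 ^ bitWeight n i.val) ∧
    (∀ T : Matrix (Fin (2 ^ n)) (Fin (2 ^ n)) (ZMod 2),
      UpperTri T → (∀ i ∈ I, T i i = 1) → polarG n i₀ ∈ ptpc n I T) := by
  obtain ⟨i, hiI, hk⟩ := Finset.exists_mem_eq_inf' hI (fun i => 2 ^ bitWeight n i.val)
  rw [hk] at hi₀ ⊢
  have hle := bitWeight_le n i.val
  rw [Nat.pow_div hle (by norm_num)] at hi₀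
  have hmem : i₀ ∈ I := by
    apply hdec i hiI
    rw [hi₀]
    exact polarLE_top n _ i.val rfl i.isLt
  have hup : ∀ j : Fin (2 ^ n), i₀ ≤ j → j ∈ I := by
    intro j hj
    apply hdec i₀ hmem
    refine Relation.ReflTransGen.single (Or.inr ?_)
    rw [hi₀]
    exact binDom_top n _ _ (Nat.sub_le _ _) (by rw [← hi₀]; exact hj) j.isLt
  refine ⟨hmem, hup, ?_, ?_⟩
  · rw [hammingNorm_polarG, hi₀, bitWeight_top n _ (Nat.sub_le _ _), Nat.sub_sub_self hle]
  · intro T hT hd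
    obtain ⟨v, hv0, hv⟩ := exists_vecMul T hT i₀ (fun j hj => hd j (hup j hj))
    refine ⟨v, ?_, ?_⟩
    · intro j hj
      exact hv0 j (not_le.mp fun h => hj (hup j h))
    · rw [hv, Matrix.single_one_vecMul]
      rfl
end
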